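/- Fix any values (Q_U,Q_V,Q_W,P_U,P_V,P_W,t₁,t₂,t₅) ∈ ℂ⁹ and let 𝒮 := [[0,1,0],[0,0,1],[1,0,0]]. Then for every ξ ∈ ℂ∖{0}: (a) ĝ(ωξ) = ĝ(ξ)·𝒮ᵀ, and (b) 𝓛(ξ) = ω·𝒮ᵀ·𝓛(ωξ)·𝒮. -/

import Mathlib

noncomputable def Lmat {K : Type*} [Field K] (qU qV qW pU pV pW t1 t2 t5 lam : K) :
    Matrix (Fin 3) (Fin 3) K :=
  !![(1/8) * qU ^ 2 - pW + (1/2) * pV - (1/4) * t5 * qU - (1/6) * t5 ^ 2,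
     (2 * t5 + (1/4) * qU) * lam
       + ((5/16) * qU * qW - pU + (1/4) * t5 * qW - (3/8) * qU * qV - (1/2) * t5 * qV + t2),
     lam ^ 2 - qV * lam
       + ((1/16) * qW ^ 2 + (7/32) * qU ^ 3 + (3/4) * qV ^ 2 - (3/2) * pW * qU
          + (5/16) * t5 * qU ^ 2 - 2 * t5 * pW + (1/4) * t5 ^ 2 * qU + t1 + (8/27) * t5 ^ 3);
     lam + (1/2) * qV - (1/4) * qW,
     2 * pW - (1/4) * qU ^ 2 + (1/2) * t5 * qU + (1/3) * t5 ^ 2,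
     (2 * t5 + (1/4) * qU) * lam
       + (-(5/16) * qU * qW + pU - (1/4) * t5 * qW - (3/8) * qU * qV - (1/2) * t5 * qV + t2);
     t5 - (1/2) * qU,
     lam + (1/2) * qV + (1/4) * qW,
     (1/8) * qU ^ 2 - pW - (1/2) * pV - (1/4) * t5 * qU - (1/6) * t5 ^ 2]

noncomputable def omg : ℂ := Complex.exp (2 * Real.pi * Complex.I / 3)

noncomputable def Umat : Matrix (Fin 3) (Fin 3) ℂ :=
  (Complex.I / (Real.sqrt 3 : ℂ)) • !![1, omg, omg ^ 2; 1, 1, 1; 1, omg ^ 2, omg]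

noncomputable def ghat (ξ : ℂ) : Matrix (Fin 3) (Fin 3) ℂ :=
  Matrix.diagonal ![ξ, 1, ξ⁻¹] * Umat

/-- The entrywise derivative `dĝ/dξ`. -/
noncomputable def ghatDeriv (ξ : ℂ) : Matrix (Fin 3) (Fin 3) ℂ :=
  Matrix.of fun i j => deriv (fun z => ghat z i j) ξ

noncomputable def calL (qU qV qW pU pV pW t1 t2 t5 : ℂ) (ξ : ℂ) :
    Matrix (Fin 3) (Fin 3) ℂ :=
  (3 * ξ ^ 2) • ((ghat ξ)⁻¹ * Lmat qU qV qW pU pV pW t1 t2 t5 (ξ ^ 3) * ghat ξ)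
    - (ghat ξ)⁻¹ * ghatDeriv ξ

noncomputable def Smat : Matrix (Fin 3) (Fin 3) ℂ := !![0, 1, 0; 0, 0, 1; 1, 0, 0]

theorem omg_pow_three : omg ^ 3 = 1 := by
  rw [omg, ← Complex.exp_nat_mul, ← Complex.exp_two_pi_mul_I]
  congr 1
  push_cast
  ring

theorem Smat_mul_transpose : Smat * Smat.transpose = 1 := by
  ext i j
  fin_cases i <;> fin_cases j <;> simp [Smat, Matrix.mul_apply, Fin.sum_univ_three]

theorem Smat_transpose_mul : Smat.transpose * Smat = 1 :=
  mul_eq_one_comm.mp Smat_mul_transpose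

theorem diagonal_omg_mul_Umat :
    Matrix.diagonal ![omg, 1, omg⁻¹] * Umat = Umat * Smat.transpose := by
  have h3 := omg_pow_three
  have hinv : omg⁻¹ = omg ^ 2 :=
    inv_eq_of_mul_eq_one_right (by linear_combination h3)
  rw [hinv, Umat, Matrix.mul_smul, Matrix.smul_mul]
  congr 1
  ext i j
  fin_cases i <;> fin_cases j <;>
    simp [Smat, Matrix.mul_apply, Matrix.diagonal_apply, Fin.sum_univ_three] <;> grind

theorem ghat_omg_mul (ξ : ℂ) : ghat (omg * ξ) = ghat ξ * Smat.transpose := by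
  rw [ghat, ghat, mul_assoc, ← diagonal_omg_mul_Umat, ← mul_assoc, Matrix.diagonal_mul_diagonal]
  congr 2
  ext i
  fin_cases i <;> simp [mul_comm]

theorem mul_Smat_transpose_apply (M : Matrix (Fin 3) (Fin 3) ℂ) (i j : Fin 3) :
    (M * Smat.transpose) i j = M i (j + 1) := by
  fin_cases j <;> simp [Smat, Matrix.mul_apply, Fin.sum_univ_three]

theorem omg_smul_ghatDeriv (ξ : ℂ) :
    omg • ghatDeriv (omg * ξ) = ghatDeriv ξ * Smat.transpose := by
  ext i j
  have h : (fun z => ghat (omg * z) i j) = fun z => ghat z i (j + 1) := by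
    funext z
    rw [ghat_omg_mul, mul_Smat_transpose_apply]
  rw [mul_Smat_transpose_apply]
  simp only [ghatDeriv, Matrix.smul_apply, Matrix.of_apply]
  rw [← h]
  exact (deriv_comp_mul_left omg (fun z => ghat z i j) ξ).symm

theorem ghat_omg_mul_inv (ξ : ℂ) : (ghat (omg * ξ))⁻¹ = Smat * (ghat ξ)⁻¹ := by
  rw [ghat_omg_mul, Matrix.mul_inv_rev, Matrix.inv_eq_left_inv Smat_mul_transpose]

theorem gauge_and_calL_symmetry (qU qV qW pU pV pW t1 t2 t5 : ℂ) (ξ : ℂ) (hξ : ξ ≠ 0) :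
    ghat (omg * ξ) = ghat ξ * Smat.transpose
    ∧ calL qU qV qW pU pV pW t1 t2 t5 ξ = omg • (Smat.transpose * calL qU qV qW pU pV pW t1 t2 t5 (omg * ξ) * Smat) := by
  refine ⟨ghat_omg_mul ξ, ?_⟩
  have conj (A : Matrix (Fin 3) (Fin 3) ℂ) :
      Smat.transpose * (Smat * A * Smat.transpose) * Smat = A := by
    rw [mul_assoc Smat, ← mul_assoc, Smat_transpose_mul, one_mul, mul_assoc,
      Smat_transpose_mul, mul_one]
  have hcube : (omg * ξ) ^ 3 = ξ ^ 3 := by rw [mul_pow, omg_pow_three, one_mul]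
  have key : omg • calL qU qV qW pU pV pW t1 t2 t5 (omg * ξ)
      = Smat * calL qU qV qW pU pV pW t1 t2 t5 ξ * Smat.transpose := by
    have hscal : omg * (3 * (omg * ξ) ^ 2) = 3 * ξ ^ 2 := by
      linear_combination 3 * ξ ^ 2 * omg_pow_three
    rw [calL, calL, smul_sub, smul_smul, hscal,
      ← Matrix.mul_smul _ omg, omg_smul_ghatDeriv, ghat_omg_mul_inv, ghat_omg_mul, hcube]
    simp only [mul_sub, sub_mul, Matrix.mul_smul, Matrix.smul_mul, mul_assoc]
  rw [← Matrix.smul_mul, ← Matrix.mul_smul, key, conj]
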